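/- Let D be a digraph, let P = x₁x₂…x_m be a path in D, and let x and y be vertices of V(D) − V(P) (possibly x = y). If there is no index i with 1 ≤ i ≤ m − 1 such that both x_i x ∈ A(D) and y x_{i+1} ∈ A(D), then d⁻(x, P) + d⁺(y, P) ≤ m + ε, where ε = 1 if x_m x ∈ A(D) and ε = 0 otherwise. Here d⁻(x, P) is the number of vertices of P that dominate x and d⁺(y, P) is the number of vertices of P dominated by y. -/

import Mathlib

/-!
Digraphs are modelled as a finite vertex type `V` together with an arc relation
`A : V → V → Prop` (irreflexive, i.e. no loops; no multiple arcs by construction).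
-/

namespace PaperDG

variable {V : Type*}

/-- Out-degree of `v`: the number of out-neighbours. -/
noncomputable def outDeg (A : V → V → Prop) (v : V) : ℕ := Nat.card {w : V // A v w}

/-- In-degree of `v`: the number of in-neighbours. -/
noncomputable def inDeg (A : V → V → Prop) (v : V) : ℕ := Nat.card {w : V // A w v}

/-- Degree `d(v) = d⁺(v) + d⁻(v)`. -/
noncomputable def deg (A : V → V → Prop) (v : V) : ℕ := outDeg A v + inDeg A v

/-- Strong connectivity: every vertex reaches every other by a directed path. -/
def IsStrong (A : V → V → Prop) : Prop := ∀ x y : V, Relation.ReflTransGen A x y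

/-- The digraph has a directed cycle through `k` distinct vertices. -/
def HasCycle (A : V → V → Prop) (k : ℕ) : Prop :=
  ∃ f : ZMod k → V, Function.Injective f ∧ ∀ i : ZMod k, A (f i) (f (i + 1))

/-- Condition (*): `d(x) + d(y) ≥ 2n - 1` and `min {d(x), d(y)} ≥ n - 1` for every pair of
non-adjacent vertices `x, y` with a common in-neighbour. -/
def CondStar [Fintype V] (A : V → V → Prop) : Prop :=
  ∀ x y : V, x ≠ y → ¬A x y → ¬A y x → (∃ u : V, A u x ∧ A u y) →
    2 * Fintype.card V - 1 ≤ deg A x + deg A y ∧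
      Fintype.card V - 1 ≤ min (deg A x) (deg A y)

/-- Condition (**): `min {d⁺(x) + d⁻(y), d⁻(x) + d⁺(y)} ≥ n` for every pair of non-adjacent
vertices `x, y` with a common in-neighbour or a common out-neighbour. -/
def CondStarStar [Fintype V] (A : V → V → Prop) : Prop :=
  ∀ x y : V, x ≠ y → ¬A x y → ¬A y x →
    ((∃ u : V, A u x ∧ A u y) ∨ (∃ u : V, A x u ∧ A y u)) →
    Fintype.card V ≤ min (outDeg A x + inDeg A y) (inDeg A x + outDeg A y)

/-- The digraph is (isomorphic to) the complete bipartite digraph `K*_{n/2,n/2}`: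
there is a part `S` of size `n/2` such that the arcs are exactly the pairs of vertices
lying in different parts. -/
def IsKhalf [Fintype V] (A : V → V → Prop) : Prop :=
  ∃ S : Set V, 2 * Nat.card S = Fintype.card V ∧
    ∀ x y : V, A x y ↔ (x ∈ S ↔ y ∉ S)

/-- The digraph is (isomorphic to) `K*_{n/2,n/2}` minus one arc. -/
def IsKhalfMinusArc [Fintype V] (A : V → V → Prop) : Prop :=
  ∃ S : Set V, ∃ a b : V, 2 * Nat.card S = Fintype.card V ∧ (a ∈ S ↔ b ∉ S) ∧
    ∀ x y : V, A x y ↔ ((x ∈ S ↔ y ∉ S) ∧ ¬(x = a ∧ y = b))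

/-- Minimum semi-degree at least `k`. -/
def MinSemiDegreeGE (A : V → V → Prop) (k : ℕ) : Prop :=
  ∀ v : V, k ≤ outDeg A v ∧ k ≤ inDeg A v

/-- Locally semicomplete: for every vertex `x` the out-neighbourhood and the
in-neighbourhood of `x` both induce semicomplete digraphs. -/
def LocallySemicomplete (A : V → V → Prop) : Prop :=
  ∀ x u v : V, u ≠ v →
    ((A x u → A x v → A u v ∨ A v u) ∧ (A u x → A v x → A u v ∨ A v u))

end PaperDG

open PaperDG

open Classical in
theorem aux_count (P Q : ℕ → Prop) (n : ℕ) (h : ∀ i < n, ¬(P i ∧ Q (i + 1))) :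
    Nat.count P (n + 1) + Nat.count Q (n + 1) ≤ n + 1 + (if P n then 1 else 0) := by
  induction n with
  | zero =>
    simp only [Nat.count_succ, Nat.count_zero]
    split_ifs <;> omega
  | succ k ih =>
    have h1 := ih (fun i hi => h i (by omega))
    have h2 := h k (by omega)
    rw [Nat.count_succ P (k + 1), Nat.count_succ Q (k + 1)]
    by_cases a : P k <;> by_cases b : Q (k + 1) <;> by_cases c : P (k + 1) <;>
      simp only [a, b, c, if_true, if_false] at h1 h2 ⊢ <;> first | omega | simp at h2

open Classical in
theorem aux_card (P : ℕ → Prop) (m : ℕ) :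
    Nat.card {i : ℕ // i < m ∧ P i} = Nat.count P m := by
  rw [Nat.count_eq_card_filter_range]
  exact Nat.subtype_card _ (by simp)

open Classical in
/-- Lemma 3 (Bang-Jensen–Gutin–Li).  The path `P = x₁x₂…x_m` is encoded by
`p : ℕ → V`, whose vertices are `p 0, …, p (m-1)`. -/
theorem bang_jensen_gutin_li_lemma3 {V : Type*} [Fintype V] (A : V → V → Prop)
    (hirr : ∀ v : V, ¬A v v)
    (m : ℕ) (hm2 : 2 ≤ m)
    (p : ℕ → V)
    (hinjP : ∀ i j : ℕ, i < m → j < m → p i = p j → i = j)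
    (hpath : ∀ i : ℕ, i + 1 < m → A (p i) (p (i + 1)))
    (x y : V)
    (hx : ∀ i : ℕ, i < m → x ≠ p i) (hy : ∀ i : ℕ, i < m → y ≠ p i)
    (hno : ¬∃ i : ℕ, i + 1 < m ∧ A (p i) x ∧ A y (p (i + 1))) :
    Nat.card {i : ℕ // i < m ∧ A (p i) x} + Nat.card {i : ℕ // i < m ∧ A y (p i)} ≤
      m + (if A (p (m - 1)) x then 1 else 0) := by
  obtain ⟨n, rfl⟩ : ∃ n, m = n + 1 := ⟨m - 1, by omega⟩
  rw [aux_card (fun i => A (p i) x), aux_card (fun i => A y (p i))]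
  exact aux_count (fun i => A (p i) x) (fun i => A y (p i)) n
    (fun i hi hc => hno ⟨i, by omega, hc.1, hc.2⟩)
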